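/- Let f : ℝ^{d_x} × ℝ^{d_y} → ℝ be L-smooth (L > 0) and satisfy the two-sided PL condition with constants μ_x, μ_y > 0 where μ_x ≤ L and μ_y ≤ L. Let g(x) := sup_y f(x,y); assume this supremum is attained for every x and g* := inf_x g(x) is finite. Assume g is differentiable and ∇g(x) = ∇_x f(x, ŷ) for every x and every maximizer ŷ of f(x, ·). Set τ_y = 1/L, λ = 6L²/μ_y², τ_x = τ_y/(22λ) = μ_y²/(132L³). Define the simultaneous GDA iterates by x_{k+1} = x_k − τ_x ∇_x f(x_k, y_k) and y_{k+1} = y_k + τ_y ∇_y f(x_k, y_k), and the Lyapunov function V_k = (g(x_k) − g*) + (λτ_x/τ_y)(g(x_k) − f(x_k, y_k)). Then for every k ≥ 0, V_{k+1} ≤ (1 − μ_x τ_x / 2) V_k. -/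

import Mathlib

noncomputable section

/-- A differentiable function `h : ℝ^d → ℝ` is `μ`-PL if its infimum is finite and
`‖∇h(z)‖² ≥ 2μ(h(z) − inf h)` for all `z`. -/
def IsPL {d : ℕ} (h : EuclideanSpace ℝ (Fin d) → ℝ) (μ : ℝ) : Prop :=
  Differentiable ℝ h ∧ BddBelow (Set.range h) ∧
    ∀ z, 2 * μ * (h z - ⨅ z', h z') ≤ ‖gradient h z‖ ^ 2

/-- `f` is `L`-smooth: it is (jointly) differentiable and its gradient is `L`-Lipschitz in the
product (ℓ²) norm: `‖∇f(x,y) − ∇f(x',y')‖² ≤ L²(‖x−x'‖² + ‖y−y'‖²)`. -/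
def LSmooth {dx dy : ℕ} (f : EuclideanSpace ℝ (Fin dx) → EuclideanSpace ℝ (Fin dy) → ℝ)
    (L : ℝ) : Prop :=
  Differentiable ℝ (fun p : EuclideanSpace ℝ (Fin dx) × EuclideanSpace ℝ (Fin dy) => f p.1 p.2) ∧
    ∀ x x' y y',
      ‖gradient (fun x'' => f x'' y) x - gradient (fun x'' => f x'' y') x'‖ ^ 2 +
          ‖gradient (f x) y - gradient (f x') y'‖ ^ 2 ≤
        L ^ 2 * (‖x - x'‖ ^ 2 + ‖y - y'‖ ^ 2)

/-- Two-sided PL condition: `f(·,y)` is `μx`-PL for every `y` and `−f(x,·)` is `μy`-PL for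
every `x`. -/
def TwoSidedPL {dx dy : ℕ} (f : EuclideanSpace ℝ (Fin dx) → EuclideanSpace ℝ (Fin dy) → ℝ)
    (μx μy : ℝ) : Prop :=
  (∀ y, IsPL (fun x => f x y) μx) ∧ (∀ x, IsPL (fun y => -f x y) μy)

/-- `p = (x̄, ȳ)` is a saddle point of `f`: `f(x̄, y) ≤ f(x̄, ȳ) ≤ f(x, ȳ)` for all `x, y`. -/
def IsSaddle {dx dy : ℕ} (f : EuclideanSpace ℝ (Fin dx) → EuclideanSpace ℝ (Fin dy) → ℝ)
    (p : EuclideanSpace ℝ (Fin dx) × EuclideanSpace ℝ (Fin dy)) : Prop :=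
  ∀ x y, f p.1 y ≤ f p.1 p.2 ∧ f p.1 p.2 ≤ f x p.2

section Gradient

variable {E : Type*} [NormedAddCommGroup E] [InnerProductSpace ℝ E] [CompleteSpace E]

theorem hasDerivAt_comp_line {h : E → ℝ} (hd : Differentiable ℝ h) (x d : E)
    (t : ℝ) : HasDerivAt (fun s : ℝ => h (x + s • d)) (inner ℝ (gradient h (x + t • d)) d) t := by
  have hline : HasDerivAt (fun s : ℝ => x + s • d) d t := by
    simpa using ((hasDerivAt_id t).smul_const d).const_add x
  rw [inner_gradient_left]
  exact (hd (x + t • d)).hasFDerivAt.comp_hasDerivAt t hline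

theorem gradient_fun_neg (h : E → ℝ) (x : E) : gradient (fun z => -h z) x = -gradient h x := by
  simp [gradient]

/-- The descent lemma: a quadratic upper bound from a gradient that is Lipschitz relative to
a base point. -/
theorem le_add_of_norm_gradient_sub_le {h : E → ℝ} (hd : Differentiable ℝ h)
    {K : ℝ} {x : E} (hK : ∀ z, ‖gradient h z - gradient h x‖ ≤ K * ‖z - x‖) (z : E) :
    h z ≤ h x + inner ℝ (gradient h x) (z - x) + K / 2 * ‖z - x‖ ^ 2 := by
  set d := z - x with hd_def
  have hderiv (t : ℝ) : HasDerivAt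
      (fun s : ℝ => h (x + s • d) - s * inner ℝ (gradient h x) d - K / 2 * ‖d‖ ^ 2 * s ^ 2)
      (inner ℝ (gradient h (x + t • d)) d - inner ℝ (gradient h x) d - K * ‖d‖ ^ 2 * t) t := by
    have h1 := ((hasDerivAt_comp_line hd x d t).sub
      ((hasDerivAt_id t).mul_const (inner ℝ (gradient h x) d))).sub
      (((hasDerivAt_id t).pow 2).const_mul (K / 2 * ‖d‖ ^ 2))
    refine h1.congr_deriv ?_
    simp only [id_eq]
    ring
  have hanti : AntitoneOn
      (fun s : ℝ => h (x + s • d) - s * inner ℝ (gradient h x) d - K / 2 * ‖d‖ ^ 2 * s ^ 2)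
      (Set.Ici 0) := by
    refine antitoneOn_of_deriv_nonpos (convex_Ici 0)
      (fun t _ => (hderiv t).continuousAt.continuousWithinAt)
      (fun t _ => (hderiv t).differentiableAt.differentiableWithinAt) fun t ht => ?_
    rw [interior_Ici, Set.mem_Ioi] at ht
    rw [(hderiv t).deriv, ← inner_sub_left]
    have h1 := hK (x + t • d)
    rw [add_sub_cancel_left, norm_smul, Real.norm_of_nonneg ht.le] at h1
    have h2 := real_inner_le_norm (gradient h (x + t • d) - gradient h x) d
    nlinarith [mul_le_mul_of_nonneg_right h1 (norm_nonneg d)]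
  have h01 := hanti (Set.mem_Ici.2 le_rfl) (Set.mem_Ici.2 zero_le_one) zero_le_one
  simp only [one_smul, zero_smul, hd_def, add_sub_cancel, add_zero] at h01
  linarith

theorem add_le_of_norm_gradient_sub_le {h : E → ℝ} (hd : Differentiable ℝ h)
    {K : ℝ} {x : E} (hK : ∀ z, ‖gradient h z - gradient h x‖ ≤ K * ‖z - x‖) (z : E) :
    h x + inner ℝ (gradient h x) (z - x) - K / 2 * ‖z - x‖ ^ 2 ≤ h z := by
  have h1 := le_add_of_norm_gradient_sub_le (h := fun w => -h w) (K := K) (x := x)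
    hd.neg (fun w => by
      rw [gradient_fun_neg, gradient_fun_neg, ← neg_sub', norm_neg]
      exact hK w) z
  rw [gradient_fun_neg, inner_neg_left] at h1
  linarith

theorem norm_gradient_le_of_sub_le {h : E → ℝ} (hd : Differentiable ℝ h)
    {K : ℝ} (hK0 : 0 ≤ K) {z : E} (hK : ∀ w, h z - K * ‖w - z‖ ≤ h w) : ‖gradient h z‖ ≤ K := by
  set G := gradient h z with hG
  have h1 := (hasDerivAt_comp_line hd z (-G) 0).tendsto_slope_zero_right
  simp only [zero_smul, add_zero, zero_add, ← hG, inner_neg_right,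
    real_inner_self_eq_norm_sq, smul_eq_mul] at h1
  have h2 : -(K * ‖G‖) ≤ -‖G‖ ^ 2 := by
    refine ge_of_tendsto h1 ?_
    filter_upwards [self_mem_nhdsWithin] with t (ht : 0 < t)
    have h3 := hK (z + t • -G)
    rw [add_sub_cancel_left, norm_smul, norm_neg, Real.norm_of_nonneg ht.le] at h3
    rw [inv_mul_eq_div, le_div_iff₀ ht]
    linarith
  rcases (norm_nonneg G).eq_or_lt with h0 | h0
  · exact h0 ▸ hK0
  · nlinarith

theorem gradient_eq_zero_of_forall_le {h : E → ℝ} {z : E} (hz : ∀ w, h w ≤ h z) :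
    gradient h z = 0 := by
  have : IsLocalMax h z := Filter.Eventually.of_forall hz
  simp [gradient, this.fderiv_eq_zero]

/-- Quadratic growth of Polyak-Łojasiewicz functions (with a non-optimal constant). -/
theorem exists_eq_and_sq_norm_sub_le_of_PL [ProperSpace E] {h : E → ℝ}
    (hd : Differentiable ℝ h) {μ m : ℝ} (hμ : 0 < μ) (hm : ∀ z, m ≤ h z)
    (hPL : ∀ z, 2 * μ * (h z - m) ≤ ‖gradient h z‖ ^ 2) (y : E) :
    ∃ z, h z = m ∧ μ / 4 * ‖y - z‖ ^ 2 ≤ h y - m := by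
  set c := √μ / 2 with hc
  have hc0 : 0 < c := by positivity
  have hc2 : c ^ 2 = μ / 4 := by rw [hc, div_pow, Real.sq_sqrt hμ.le]; norm_num
  set φ := fun z => √(h z - m) with hφ
  have hφ0 (z : E) : 0 ≤ φ z := Real.sqrt_nonneg _
  have hφ2 (z : E) : φ z ^ 2 = h z - m := Real.sq_sqrt (sub_nonneg.2 (hm z))
  have hcont : Continuous fun z => φ z + c * dist z y := by
    have := hd.continuous
    fun_prop
  obtain ⟨z, hz⟩ := hcont.exists_forall_le (Filter.tendsto_atTop_mono
    (fun z => le_add_of_nonneg_left (hφ0 z))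
    ((tendsto_dist_right_cocompact_atTop y).const_mul_atTop hc0))
  have hlow (w : E) : h z - 2 * c * φ z * ‖w - z‖ ≤ h w := by
    have h1 : φ z ≤ φ w + c * ‖w - z‖ := by
      have := mul_le_mul_of_nonneg_left (dist_triangle w z y) hc0.le
      rw [← dist_eq_norm]
      linarith [hz w]
    have h2 := mul_nonneg hc0.le (norm_nonneg (w - z))
    nlinarith [hφ2 z, hφ2 w, hφ0 z, hφ0 w, mul_nonneg (hφ0 z) (sub_nonneg.2 h1),
      mul_nonneg (hφ0 w) (sub_nonneg.2 h1), sq_nonneg (φ w - φ z)]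
  have hgrad := norm_gradient_le_of_sub_le hd (K := 2 * c * φ z)
    (by have := hφ0 z; positivity) hlow
  have hzero : φ z = 0 := by
    have h1 := hPL z
    have h2 := pow_le_pow_left₀ (norm_nonneg _) hgrad 2
    rw [mul_pow, mul_pow, hc2] at h2
    rw [← hφ2] at h1
    have h3 : μ * φ z ^ 2 ≤ 0 := by linarith
    have h4 : φ z ^ 2 ≤ 0 := by
      by_contra! h5
      nlinarith
    exact pow_eq_zero_iff two_ne_zero |>.1 (le_antisymm h4 (sq_nonneg _))
  refine ⟨z, by have := hφ2 z; rw [hzero] at this; linarith, ?_⟩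
  have h1 := hz y
  rw [hzero, dist_self, dist_comm, dist_eq_norm] at h1
  rw [← hc2, ← mul_pow, ← hφ2]
  exact pow_le_pow_left₀ (by positivity) (by linarith) 2

end Gradient

section MinMax

variable {dx dy : ℕ} {f : EuclideanSpace ℝ (Fin dx) → EuclideanSpace ℝ (Fin dy) → ℝ}
  {L μx μy : ℝ}

theorem LSmooth.norm_gradient_left_sub_le (hf : LSmooth f L) (hL : 0 ≤ L)
    (x z : EuclideanSpace ℝ (Fin dx)) (y : EuclideanSpace ℝ (Fin dy)) :
    ‖gradient (fun x' => f x' y) z - gradient (fun x' => f x' y) x‖ ≤ L * ‖z - x‖ := by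
  have h := hf.2 z x y y
  rw [sub_self y, norm_zero] at h
  refine le_of_sq_le_sq ?_ (by positivity)
  nlinarith [sq_nonneg ‖gradient (f z) y - gradient (f x) y‖]

theorem LSmooth.norm_gradient_left_sub_le' (hf : LSmooth f L) (hL : 0 ≤ L)
    (x : EuclideanSpace ℝ (Fin dx)) (y w : EuclideanSpace ℝ (Fin dy)) :
    ‖gradient (fun x' => f x' w) x - gradient (fun x' => f x' y) x‖ ≤ L * ‖w - y‖ := by
  have h := hf.2 x x w y
  rw [sub_self x, norm_zero] at h
  refine le_of_sq_le_sq ?_ (by positivity)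
  nlinarith [sq_nonneg ‖gradient (f x) w - gradient (f x) y‖]

theorem LSmooth.norm_gradient_right_sub_le (hf : LSmooth f L) (hL : 0 ≤ L)
    (x : EuclideanSpace ℝ (Fin dx)) (y w : EuclideanSpace ℝ (Fin dy)) :
    ‖gradient (f x) w - gradient (f x) y‖ ≤ L * ‖w - y‖ := by
  have h := hf.2 x x w y
  rw [sub_self x, norm_zero] at h
  refine le_of_sq_le_sq ?_ (by positivity)
  nlinarith [sq_nonneg ‖gradient (fun x' => f x' w) x - gradient (fun x' => f x' y) x‖]

theorem LSmooth.norm_gradient_right_sub_le' (hf : LSmooth f L) (hL : 0 ≤ L)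
    (x z : EuclideanSpace ℝ (Fin dx)) (y : EuclideanSpace ℝ (Fin dy)) :
    ‖gradient (f z) y - gradient (f x) y‖ ≤ L * ‖z - x‖ := by
  have h := hf.2 z x y y
  rw [sub_self y, norm_zero] at h
  refine le_of_sq_le_sq ?_ (by positivity)
  nlinarith [sq_nonneg ‖gradient (fun x' => f x' y) z - gradient (fun x' => f x' y) x‖]

variable {g : EuclideanSpace ℝ (Fin dx) → ℝ}

theorem TwoSidedPL.two_mul_sub_le_sq_norm_gradient_right (hPL : TwoSidedPL f μx μy)
    (hg : ∀ x, g x = ⨆ y, f x y)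
    (x : EuclideanSpace ℝ (Fin dx)) (y : EuclideanSpace ℝ (Fin dy)) :
    2 * μy * (g x - f x y) ≤ ‖gradient (f x) y‖ ^ 2 := by
  have h := (hPL.2 x).2.2 y
  have hinf : ⨅ y', -f x y' = -g x := by
    rw [hg, iInf, Real.sInf_def, iSup, Set.neg_range]
    simp only [neg_neg]
  rw [gradient_fun_neg, norm_neg, hinf] at h
  linarith

theorem TwoSidedPL.le_sup (hPL : TwoSidedPL f μx μy) (hg : ∀ x, g x = ⨆ y, f x y)
    (x : EuclideanSpace ℝ (Fin dx)) (y : EuclideanSpace ℝ (Fin dy)) : f x y ≤ g x := by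
  obtain ⟨b, hb⟩ := (hPL.2 x).2.1
  rw [hg]
  refine le_ciSup (f := f x) ⟨-b, ?_⟩ y
  rintro _ ⟨w, rfl⟩
  linarith [hb ⟨w, rfl⟩]

theorem TwoSidedPL.exists_argmax_near (hPL : TwoSidedPL f μx μy) (hμy : 0 < μy)
    (hg : ∀ x, g x = ⨆ y, f x y)
    (x : EuclideanSpace ℝ (Fin dx)) (y : EuclideanSpace ℝ (Fin dy)) :
    ∃ w, f x w = g x ∧ μy / 4 * ‖y - w‖ ^ 2 ≤ g x - f x y := by
  obtain ⟨w, hw, hyw⟩ := exists_eq_and_sq_norm_sub_le_of_PL (hPL.2 x).1 (m := -g x) hμy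
    (fun z => neg_le_neg (hPL.le_sup hg x z))
    (fun z => by
      rw [gradient_fun_neg, norm_neg]
      linarith [hPL.two_mul_sub_le_sq_norm_gradient_right hg x z]) y
  exact ⟨w, neg_injective hw, by linarith⟩

/-- The primal function `g = sup_y f(·, y)` inherits the PL condition in `x`. -/
theorem TwoSidedPL.two_mul_sub_le_sq_norm_gradient_sup (hPL : TwoSidedPL f μx μy) (hμx : 0 < μx)
    (hμy : 0 < μy) (hg : ∀ x, g x = ⨆ y, f x y)
    (hgrad : ∀ x y, (∀ y', f x y' ≤ f x y) → gradient g x = gradient (fun x' => f x' y) x)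
    (x : EuclideanSpace ℝ (Fin dx)) :
    2 * μx * (g x - ⨅ x', g x') ≤ ‖gradient g x‖ ^ 2 := by
  obtain ⟨w, hw, -⟩ := hPL.exists_argmax_near hμy hg x 0
  rw [hgrad x w fun y' => hw ▸ hPL.le_sup hg x y']
  refine le_trans ?_ ((hPL.1 w).2.2 x)
  have hinf : ⨅ x', f x' w ≤ ⨅ x', g x' := ciInf_mono (hPL.1 w).2.1 fun z => hPL.le_sup hg z w
  simp only [hw]
  gcongr

theorem LSmooth.norm_gradient_sup_sub_le (hf : LSmooth f L) (hL : 0 < L)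
    (hPL : TwoSidedPL f μx μy) (hμy : 0 < μy) (hμyL : μy ≤ L) (hg : ∀ x, g x = ⨆ y, f x y)
    (hgrad : ∀ x y, (∀ y', f x y' ≤ f x y) → gradient g x = gradient (fun x' => f x' y) x)
    (x z : EuclideanSpace ℝ (Fin dx)) :
    ‖gradient g z - gradient g x‖ ≤ 2 * L ^ 2 / μy * ‖z - x‖ := by
  obtain ⟨w, hw, -⟩ := hPL.exists_argmax_near hμy hg x 0
  obtain ⟨v, hv, hwv⟩ := hPL.exists_argmax_near hμy hg z w
  have hwmax (y') : f x y' ≤ f x w := hw ▸ hPL.le_sup hg x y'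
  have hvmax (y') : f z y' ≤ f z v := hv ▸ hPL.le_sup hg z y'
  have hPLz := hPL.two_mul_sub_le_sq_norm_gradient_right hg z w
  have hwz := hf.norm_gradient_right_sub_le' hL.le x z w
  rw [gradient_eq_zero_of_forall_le hwmax, sub_zero] at hwz
  have hwz2 := pow_le_pow_left₀ (norm_nonneg _) hwz 2
  have hdist : μy ^ 2 * ‖w - v‖ ^ 2 ≤ 2 * L ^ 2 * ‖z - x‖ ^ 2 := by
    nlinarith [mul_le_mul_of_nonneg_left hwv hμy.le]
  have hsm := hf.2 z x v w
  rw [← hgrad x w hwmax, ← hgrad z v hvmax, norm_sub_rev v w] at hsm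
  have hsq : μy ^ 2 * ‖gradient g z - gradient g x‖ ^ 2 ≤ (2 * L ^ 2 * ‖z - x‖) ^ 2 := by
    have h1 : ‖gradient g z - gradient g x‖ ^ 2 ≤ L ^ 2 * (‖z - x‖ ^ 2 + ‖w - v‖ ^ 2) := by
      linarith [sq_nonneg ‖gradient (f z) v - gradient (f x) w‖]
    have h2 : μy ^ 2 ≤ L ^ 2 := pow_le_pow_left₀ hμy.le hμyL 2
    calc μy ^ 2 * ‖gradient g z - gradient g x‖ ^ 2
        ≤ μy ^ 2 * (L ^ 2 * (‖z - x‖ ^ 2 + ‖w - v‖ ^ 2)) := by gcongr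
      _ = L ^ 2 * (μy ^ 2 * ‖z - x‖ ^ 2 + μy ^ 2 * ‖w - v‖ ^ 2) := by ring
      _ ≤ L ^ 2 * (L ^ 2 * ‖z - x‖ ^ 2 + 2 * L ^ 2 * ‖z - x‖ ^ 2) := by gcongr
      _ ≤ (2 * L ^ 2 * ‖z - x‖) ^ 2 := by nlinarith [sq_nonneg (L ^ 2 * ‖z - x‖)]
  rw [← mul_pow] at hsq
  rw [div_mul_eq_mul_div, le_div_iff₀ hμy, mul_comm _ μy]
  exact le_of_sq_le_sq hsq (by positivity)

/-- Decrease of the primal function along one inexact gradient step. -/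
theorem LSmooth.sup_sub_smul_gradient_le (hf : LSmooth f L) (hL : 0 < L)
    (hPL : TwoSidedPL f μx μy) (hμy : 0 < μy) (hμyL : μy ≤ L) (hg : ∀ x, g x = ⨆ y, f x y)
    (hgdiff : Differentiable ℝ g)
    (hgrad : ∀ x y, (∀ y', f x y' ≤ f x y) → gradient g x = gradient (fun x' => f x' y) x)
    {τ : ℝ} (hτ : 0 ≤ τ) (x : EuclideanSpace ℝ (Fin dx)) (y : EuclideanSpace ℝ (Fin dy)) :
    g (x - τ • gradient (fun x' => f x' y) x) ≤ g x - τ / 2 * ‖gradient g x‖ ^ 2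
      - (τ / 2 - L ^ 2 / μy * τ ^ 2) * ‖gradient (fun x' => f x' y) x‖ ^ 2
      + 2 * τ * L ^ 2 / μy * (g x - f x y) := by
  set u := gradient (fun x' => f x' y) x with hu
  have hdesc := le_add_of_norm_gradient_sub_le hgdiff
    (hf.norm_gradient_sup_sub_le hL hPL hμy hμyL hg hgrad x) (x - τ • u)
  rw [sub_sub_cancel_left, norm_neg, norm_smul, Real.norm_of_nonneg hτ, inner_neg_right,
    inner_smul_right] at hdesc
  obtain ⟨w, hw, hyw⟩ := hPL.exists_argmax_near hμy hg x y
  have hdiff : ‖gradient g x - u‖ ^ 2 ≤ 4 * L ^ 2 / μy * (g x - f x y) := by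
    rw [hgrad x w fun y' => hw ▸ hPL.le_sup hg x y']
    have h1 := pow_le_pow_left₀ (norm_nonneg _) (hf.norm_gradient_left_sub_le' hL.le x y w) 2
    rw [norm_sub_rev w y, mul_pow] at h1
    calc _ ≤ L ^ 2 * ‖y - w‖ ^ 2 := h1
      _ = 4 * L ^ 2 / μy * (μy / 4 * ‖y - w‖ ^ 2) := by field_simp
      _ ≤ _ := by gcongr
  rw [norm_sub_sq_real] at hdiff
  have h2 := mul_le_mul_of_nonneg_left hdiff hτ
  have h3 : τ * (4 * L ^ 2 / μy * (g x - f x y)) = 2 * (2 * τ * L ^ 2 / μy * (g x - f x y)) := by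
    ring
  have h4 : 2 * L ^ 2 / μy / 2 * (τ * ‖u‖) ^ 2 = L ^ 2 / μy * τ ^ 2 * ‖u‖ ^ 2 := by ring
  linarith

/-- Change of `f` along one simultaneous gradient descent-ascent step, with ascent step `1 / L`. -/
theorem LSmooth.le_apply_gda_step (hf : LSmooth f L) (hL : 0 < L) (hPL : TwoSidedPL f μx μy)
    {τ : ℝ} (hτ : 0 ≤ τ) (x : EuclideanSpace ℝ (Fin dx)) (y : EuclideanSpace ℝ (Fin dy)) :
    f x y + (1 / (2 * L) - τ / 2) * ‖gradient (f x) y‖ ^ 2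
        - (3 / 2 * τ + L * τ ^ 2 / 2) * ‖gradient (fun x' => f x' y) x‖ ^ 2
      ≤ f (x - τ • gradient (fun x' => f x' y) x) (y + (1 / L) • gradient (f x) y) := by
  set u := gradient (fun x' => f x' y) x with hu
  set v := gradient (f x) y with hv
  set w := y + (1 / L) • v with hw
  have hLinv : 0 ≤ 1 / L := by positivity
  have hdy : Differentiable ℝ (f x) := by simpa using (hPL.2 x).1.neg
  have hasc := add_le_of_norm_gradient_sub_le hdy
    (fun z => hf.norm_gradient_right_sub_le hL.le x y z) w
  rw [hw, add_sub_cancel_left, ← hv, inner_smul_right, real_inner_self_eq_norm_sq, norm_smul,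
    Real.norm_of_nonneg hLinv, ← hw] at hasc
  have hdesc := add_le_of_norm_gradient_sub_le (hPL.1 w).1
    (fun z => hf.norm_gradient_left_sub_le hL.le x z w) (x - τ • u)
  rw [sub_sub_cancel_left, norm_neg, norm_smul, Real.norm_of_nonneg hτ, inner_neg_right,
    inner_smul_right] at hdesc
  have hinner : inner ℝ (gradient (fun x' => f x' w) x) u ≤ 3 / 2 * ‖u‖ ^ 2 + ‖v‖ ^ 2 / 2 := by
    have h1 := real_inner_le_norm (gradient (fun x' => f x' w) x - u) u
    have h2 := hf.norm_gradient_left_sub_le' hL.le x y w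
    rw [hw, add_sub_cancel_left, norm_smul, Real.norm_of_nonneg hLinv, ← hw, ← hu,
      ← mul_assoc, mul_one_div_cancel hL.ne', one_mul] at h2
    rw [inner_sub_left, real_inner_self_eq_norm_sq] at h1
    nlinarith [mul_le_mul_of_nonneg_right h2 (norm_nonneg u), sq_nonneg (‖v‖ - ‖u‖)]
  have h3 := mul_le_mul_of_nonneg_left hinner hτ
  have h4 : 1 / L * ‖v‖ ^ 2 - L / 2 * (1 / L * ‖v‖) ^ 2 = 1 / (2 * L) * ‖v‖ ^ 2 := by
    field_simp
    ring
  linarith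

end MinMax

theorem stmt7 {dx dy : ℕ} (f : EuclideanSpace ℝ (Fin dx) → EuclideanSpace ℝ (Fin dy) → ℝ)
    (L μx μy : ℝ) (hL : 0 < L) (hμx : 0 < μx) (hμy : 0 < μy)
    (hμxL : μx ≤ L) (hμyL : μy ≤ L)
    (hsmooth : LSmooth f L)
    (hPL : TwoSidedPL f μx μy)
    (g : EuclideanSpace ℝ (Fin dx) → ℝ) (hg : ∀ x, g x = ⨆ y, f x y)
    (hatt : ∀ x, ∃ y, ∀ y', f x y' ≤ f x y)
    (hbdd : BddBelow (Set.range g))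
    (hgdiff : Differentiable ℝ g)
    (hgrad : ∀ x y, (∀ y', f x y' ≤ f x y) →
      gradient g x = gradient (fun x' => f x' y) x)
    (τx τy lam : ℝ) (hτy : τy = 1 / L) (hlam : lam = 6 * L ^ 2 / μy ^ 2)
    (hτx : τx = τy / (22 * lam))
    (x : ℕ → EuclideanSpace ℝ (Fin dx)) (y : ℕ → EuclideanSpace ℝ (Fin dy))
    (hxiter : ∀ k, x (k + 1) = x k - τx • gradient (fun x' => f x' (y k)) (x k))
    (hyiter : ∀ k, y (k + 1) = y k + τy • gradient (f (x k)) (y k))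
    (V : ℕ → ℝ)
    (hV : ∀ k, V k = (g (x k) - ⨅ x', g x') +
      lam * τx / τy * (g (x k) - f (x k) (y k))) :
    ∀ k, V (k + 1) ≤ (1 - μx * τx / 2) * V k := by
  intro k
  have hτ0 : 0 < τx := by rw [hτx, hτy, hlam]; positivity
  have hτ : τx * (132 * L ^ 3) = μy ^ 2 := by
    rw [hτx, hτy, hlam]
    field_simp
    norm_num
  have hweight : lam * τx / τy = 1 / 22 := by
    rw [hτx, hτy, hlam]
    field_simp
  have hG := hPL.two_mul_sub_le_sq_norm_gradient_sup hμx hμy hg hgrad (x k)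
  have hv := hPL.two_mul_sub_le_sq_norm_gradient_right hg (x k) (y k)
  have hgstep := hsmooth.sup_sub_smul_gradient_le hL hPL hμy hμyL hg hgdiff hgrad hτ0.le
    (x k) (y k)
  have hfstep := hsmooth.le_apply_gda_step hL hPL hτ0.le (x k) (y k)
  rw [← hτy, ← hxiter, ← hyiter] at hfstep
  rw [← hxiter] at hgstep
  rw [hV, hV, hweight]
  have hP : 0 ≤ g (x k) - ⨅ x', g x' := sub_nonneg.2 (ciInf_le hbdd _)
  have hD : 0 ≤ g (x k) - f (x k) (y k) := sub_nonneg.2 (hPL.le_sup hg _ _)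
  have hW0 := sq_nonneg ‖gradient (f (x k)) (y k)‖
  generalize (⨅ x', g x') = m at *
  generalize ‖gradient g (x k)‖ ^ 2 = A at *
  have hU0 := sq_nonneg ‖gradient (fun x' => f x' (y k)) (x k)‖
  generalize ‖gradient (fun x' => f x' (y k)) (x k)‖ ^ 2 = U at *
  generalize ‖gradient (f (x k)) (y k)‖ ^ 2 = W at *
  have hτeq : τx = μy ^ 2 / (132 * L ^ 3) := by rw [← hτ]; field_simp
  have hratio : μy / L ≤ 1 := (div_le_one hL).2 hμyL
  have hLτ : L * τx ≤ 1 / 132 := by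
    have h1 : L * τx = (μy / L) ^ 2 / 132 := by rw [hτeq]; field_simp
    have h2 : (μy / L) ^ 2 ≤ 1 := pow_le_one₀ (by positivity) hratio
    linarith
  have hκτ : L ^ 2 / μy * τx ≤ 1 / 132 := by
    have h1 : L ^ 2 / μy * τx = μy / L / 132 := by rw [hτeq]; field_simp
    linarith
  have hDcoef : 2 * τx * L ^ 2 / μy = μy / L / 66 := by
    rw [hτeq]
    field_simp
    norm_num
  have hμτ : μx * τx ≤ μy / L / 132 := by
    have h1 : L * τx = (μy / L) ^ 2 / 132 := by rw [hτeq]; field_simp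
    have h2 := mul_le_mul_of_nonneg_right hμxL hτ0.le
    have h3 : (μy / L) ^ 2 ≤ μy / L := pow_le_of_le_one (by positivity) hratio two_ne_zero
    linarith
  have hvL : 2 * (μy / L) * (g (x k) - f (x k) (y k)) ≤ W / L := by
    rw [le_div_iff₀ hL]
    calc _ = 2 * μy * (g (x k) - f (x k) (y k)) := by field_simp
      _ ≤ W := hv
  have hWτ : τx * W ≤ W / L / 132 := by
    have h1 : τx ≤ 1 / L / 132 := by
      rw [div_div, mul_comm L, ← div_div, le_div_iff₀ hL]
      linarith
    calc τx * W ≤ 1 / L / 132 * W := by gcongr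
      _ = W / L / 132 := by ring
  have hAτ := mul_le_mul_of_nonneg_left hG hτ0.le
  have hUτ := mul_nonneg hτ0.le hU0
  have hUκ := mul_le_mul_of_nonneg_right hκτ hUτ
  have hUL := mul_le_mul_of_nonneg_right hLτ hUτ
  have hDμ := mul_le_mul_of_nonneg_right hμτ hD
  have hPμ := mul_nonneg (mul_pos hμx hτ0).le hP
  have hDq := mul_nonneg (div_pos hμy hL).le hD
  rw [hDcoef] at hgstep
  have hWsplit : 1 / (2 * L) * W = W / L / 2 := by field_simp
  generalize μy / L = q at *
  nlinarith
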